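/- arXiv:math/9906101 — 2 statements merged into one kernel-verified Lean document; each statement's English description precedes it below -/
import Mathlib

section
/- For all x ∈ ℂ, the element r = x(X₊∧X₋ + V₊∧W₋ + ½V₋∧V₋ + ½W₊∧W₊) of G⊗G for the osp(2|2) Lie superalgebra G defines a co-Lie structure by δ_r(z) := z·r; that is, δ_r satisfies the parity condition, graded antisymmetry, the graded co-Jacobi identity, and the 1-cocycle condition. -/
noncomputable section

open scoped BigOperators

/-- The underlying vector space of `osp(2|2)`, with coordinates in the basis
`(g₀,…,g₇) = (H, X₊, X₋, B, V₊, V₋, W₊, W₋)`. -/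
abbrev G := Fin 8 → ℂ

/-- `G ⊗ G`, represented by coefficient matrices in the basis `gᵢ ⊗ gⱼ`. -/
abbrev TT := Fin 8 → Fin 8 → ℂ

/-- The grade: `H, X₊, X₋, B` are even (0); `V₊, V₋, W₊, W₋` are odd (1). -/
def gr (i : Fin 8) : ℕ := if i.val < 4 then 0 else 1

/-- The sign `z(i,j) = (−1)^{|i||j|}`. -/
def zz (i j : Fin 8) : ℂ := (-1 : ℂ) ^ (gr i * gr j)

/-- Structure constants of `osp(2|2)` (on `ℕ` indices, 0 outside the table). -/
def cNat : ℕ → ℕ → ℕ → ℂ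
  | 0,1,1 => 1 | 1,0,1 => -1
  | 0,2,2 => -1 | 2,0,2 => 1
  | 1,2,0 => -2 | 2,1,0 => 2
  | 0,4,4 => 1/2 | 4,0,4 => -1/2
  | 0,5,5 => -1/2 | 5,0,5 => 1/2
  | 0,6,6 => 1/2 | 6,0,6 => -1/2
  | 0,7,7 => -1/2 | 7,0,7 => 1/2
  | 3,4,4 => 1/2 | 4,3,4 => -1/2
  | 3,5,5 => 1/2 | 5,3,5 => -1/2
  | 3,6,6 => -1/2 | 6,3,6 => 1/2
  | 3,7,7 => -1/2 | 7,3,7 => 1/2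
  | 1,5,4 => -1 | 5,1,4 => 1
  | 2,4,5 => 1 | 4,2,5 => -1
  | 1,7,6 => -1 | 7,1,6 => 1
  | 2,6,7 => 1 | 6,2,7 => -1
  | 4,7,0 => 1 | 4,7,3 => -1 | 7,4,0 => 1 | 7,4,3 => -1
  | 6,5,0 => 1 | 6,5,3 => 1 | 5,6,0 => 1 | 5,6,3 => 1
  | 4,6,1 => 1 | 6,4,1 => 1
  | 5,7,2 => 1 | 7,5,2 => 1
  | _,_,_ => 0

/-- Structure constants `c i j k`, so that `μ(gᵢ,gⱼ) = Σ_k c i j k • g_k`. -/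
def c (i j k : Fin 8) : ℂ := cNat i.val j.val k.val

/-- The bracket `μ` of `osp(2|2)`, extended bilinearly from the basis. -/
def mu (u v : G) : G := fun k => ∑ i, ∑ j, u i * v j * c i j k

/-- The basis vectors `g₀,…,g₇`. -/
def e (i : Fin 8) : G := Pi.single i 1

/-- Membership in the even part `G₀ = span{H, X₊, X₋, B}`. -/
def isEven (v : G) : Prop := ∀ i : Fin 8, 4 ≤ i.val → v i = 0

/-- Membership in the odd part `G₁ = span{V₊, V₋, W₊, W₋}`. -/
def isOdd (v : G) : Prop := ∀ i : Fin 8, i.val < 4 → v i = 0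

/-- The action of the basis vector `gᵢ` on `G ⊗ G`:
`gᵢ·(u⊗v) = μ(gᵢ,u)⊗v + (−1)^{|i||u|} u⊗μ(gᵢ,v)`. -/
def actB (i : Fin 8) (r : TT) : TT :=
  fun p q => (∑ j, c i j p * r j q) + zz i p * ∑ j, c i j q * r p j

/-- The (bilinearly extended) action `x ↦ x·r` of `G` on `G ⊗ G`, as a linear map in `x`. -/
def actL (r : TT) : G →ₗ[ℂ] TT :=
  ∑ i : Fin 8, LinearMap.smulRight (LinearMap.proj i : G →ₗ[ℂ] ℂ) (actB i r)

/-- The graded wedge `gᵢ ∧ gⱼ = gᵢ⊗gⱼ − (−1)^{|i||j|} gⱼ⊗gᵢ` as an element of `G ⊗ G`. -/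
def wdg (i j : Fin 8) : TT :=
  fun p q => (if p = i ∧ q = j then (1 : ℂ) else 0)
    - zz i j * (if p = j ∧ q = i then (1 : ℂ) else 0)

/-- Parity condition: for homogeneous `x` of grade `a`, `δ x` lies in the sum of the
`G_b ⊗ G_c` with `b + c ≡ a (mod 2)`. -/
def Parity (δ : G →ₗ[ℂ] TT) : Prop :=
  (∀ x, isEven x → ∀ p q : Fin 8, (gr p + gr q) % 2 = 1 → δ x p q = 0) ∧
  (∀ x, isOdd x → ∀ p q : Fin 8, (gr p + gr q) % 2 = 0 → δ x p q = 0)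

/-- Graded antisymmetry of the values of `δ`: `f_i^{jk} = −(−1)^{|j||k|} f_i^{kj}`. -/
def Antisym (δ : G →ₗ[ℂ] TT) : Prop :=
  ∀ i j k : Fin 8, δ (e i) j k = - zz j k * δ (e i) k j

/-- The graded co-Jacobi identity for the structure constants `f_i^{jk} = δ(gᵢ) j k`. -/
def CoJacobi (δ : G →ₗ[ℂ] TT) : Prop :=
  ∀ i k l m : Fin 8, ∑ j : Fin 8,
    (δ (e i) k j * δ (e j) l m * zz k m + δ (e i) l j * δ (e j) m k * zz l k
      + δ (e i) m j * δ (e j) k l * zz m l) = 0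

/-- The 1-cocycle condition `δ(μ(x,y)) = x·δ(y) − (−1)^{|x||y|} y·δ(x)` for homogeneous
`x, y` (the sign is `+1` unless both are odd). -/
def Cocycle (δ : G →ₗ[ℂ] TT) : Prop :=
  (∀ x y, (isEven x ∨ isEven y) → δ (mu x y) = actL (δ y) x - actL (δ x) y) ∧
  (∀ x y, isOdd x → isOdd y → δ (mu x y) = actL (δ y) x + actL (δ x) y)

/-- A co-Lie structure (Lie super-bialgebra structure) on `osp(2|2)`. -/
def IsCoLie (δ : G →ₗ[ℂ] TT) : Prop := Parity δ ∧ Antisym δ ∧ CoJacobi δ ∧ Cocycle δ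

/-- Twice the structure constants, as integers. -/
def cNatZ : ℕ → ℕ → ℕ → ℤ
  | 0,1,1 => 2 | 1,0,1 => -2 | 0,2,2 => -2 | 2,0,2 => 2 | 1,2,0 => -4
  | 2,1,0 => 4 | 0,4,4 => 1 | 4,0,4 => -1 | 0,5,5 => -1 | 5,0,5 => 1
  | 0,6,6 => 1 | 6,0,6 => -1 | 0,7,7 => -1 | 7,0,7 => 1 | 3,4,4 => 1
  | 4,3,4 => -1 | 3,5,5 => 1 | 5,3,5 => -1 | 3,6,6 => -1 | 6,3,6 => 1
  | 3,7,7 => -1 | 7,3,7 => 1 | 1,5,4 => -2 | 5,1,4 => 2 | 2,4,5 => 2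
  | 4,2,5 => -2 | 1,7,6 => -2 | 7,1,6 => 2 | 2,6,7 => 2 | 6,2,7 => -2
  | 4,7,0 => 2 | 4,7,3 => -2 | 7,4,0 => 2 | 7,4,3 => -2 | 6,5,0 => 2
  | 6,5,3 => 2 | 5,6,0 => 2 | 5,6,3 => 2 | 4,6,1 => 2 | 6,4,1 => 2
  | 5,7,2 => 2 | 7,5,2 => 2
  | _,_,_ => 0

/-- The integral structure constants of the cobracket of the `r`-matrix with `x = 1`. -/
def fNatZ : ℕ → ℕ → ℕ → ℤ
  | 0,5,5 => -1 | 0,6,6 => 1 | 1,0,1 => 2 | 1,1,0 => -2 | 1,4,5 => -1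
  | 1,4,6 => -1 | 1,5,4 => -1 | 1,6,4 => -1 | 2,0,2 => 2 | 2,2,0 => -2
  | 2,5,7 => 1 | 2,6,7 => 1 | 2,7,5 => 1 | 2,7,6 => 1 | 3,5,5 => 1
  | 3,6,6 => -1 | 4,0,4 => 1 | 4,1,5 => -1 | 4,1,6 => 1 | 4,3,4 => -1
  | 4,4,0 => -1 | 4,4,3 => 1 | 4,5,1 => 1 | 4,6,1 => -1 | 5,0,6 => 1
  | 5,3,6 => 1 | 5,6,0 => -1 | 5,6,3 => -1 | 6,0,5 => 1 | 6,3,5 => 1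
  | 6,5,0 => -1 | 6,5,3 => -1 | 7,0,7 => 1 | 7,2,5 => 1 | 7,2,6 => -1
  | 7,3,7 => -1 | 7,5,2 => -1 | 7,6,2 => 1 | 7,7,0 => -1 | 7,7,3 => 1
  | _,_,_ => 0

def cZ (i j k : Fin 8) : ℤ := cNatZ i.val j.val k.val
def fZ (i j k : Fin 8) : ℤ := fNatZ i.val j.val k.val
def zZ (i j : Fin 8) : ℤ := if 4 ≤ i.val then (if 4 ≤ j.val then -1 else 1) else 1

/-- The integral coefficients of the `r`-matrix with `x = 1`. -/
def rZ (p q : Fin 8) : ℤ :=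
  match p.val, q.val with
  | 1, 2 => 1 | 2, 1 => -1 | 4, 7 => 1 | 7, 4 => 1 | 5, 5 => 1 | 6, 6 => 1
  | _, _ => 0

set_option maxHeartbeats 1000000 in
lemma cNat_eq (i j k : ℕ) : cNat i j k = (cNatZ i j k : ℂ) / 2 := by
  unfold cNat cNatZ
  split <;> norm_num

lemma c_eq (i j k : Fin 8) : c i j k = (cZ i j k : ℂ) / 2 := cNat_eq _ _ _

lemma zz_eq (i j : Fin 8) : zz i j = (zZ i j : ℂ) := by
  unfold zz zZ gr
  split_ifs <;> first | omega | simp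

lemma r_eq (x : ℂ) : (x • (wdg 1 2 + wdg 4 7
      + (1/2 : ℂ) • wdg 5 5 + (1/2 : ℂ) • wdg 6 6)) = fun p q => x * (rZ p q : ℂ) := by
  funext p q
  simp only [Pi.smul_apply, Pi.add_apply, smul_eq_mul, wdg, zz_eq]
  congr 1
  fin_cases p <;> fin_cases q <;> simp [rZ, zZ] <;> norm_num

lemma fZ_eq : ∀ i p q : Fin 8,
    (∑ j, cZ i j p * rZ j q) + zZ i p * ∑ j, cZ i j q * rZ p j = 2 * fZ i p q := by
  decide +kernel

lemma antisymZ : ∀ i j k : Fin 8, fZ i j k = - zZ j k * fZ i k j := by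
  decide +kernel

lemma coJacobiZ : ∀ i k l m : Fin 8, ∑ j : Fin 8,
    (fZ i k j * fZ j l m * zZ k m + fZ i l j * fZ j m k * zZ l k
      + fZ i m j * fZ j k l * zZ m l) = 0 := by
  decide +kernel

lemma cocycleZ : ∀ i j p q : Fin 8, ∑ k, cZ i j k * fZ k p q =
    ((∑ k, cZ i k p * fZ j k q) + zZ i p * ∑ k, cZ i k q * fZ j p k) -
    zZ i j * ((∑ k, cZ j k p * fZ i k q) + zZ j p * ∑ k, cZ j k q * fZ i p k) := by
  decide +kernel

lemma parityZ : ∀ i p q : Fin 8, (gr i + gr p + gr q) % 2 = 1 → fZ i p q = 0 := by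
  decide +kernel

lemma actL_apply (r : TT) (u : G) (p q : Fin 8) :
    actL r u p q = ∑ i, u i * actB i r p q := by
  simp [actL, Finset.sum_apply]

lemma actB_sum (i : Fin 8) (y : G) (T : Fin 8 → TT) (p q : Fin 8) :
    actB i (fun p q => ∑ j, y j * T j p q) p q = ∑ j, y j * actB i (T j) p q := by
  simp only [actB, Finset.mul_sum, mul_add, Finset.sum_add_distrib]
  congr 1
  · rw [Finset.sum_comm]
    exact Finset.sum_congr rfl fun _ _ => Finset.sum_congr rfl fun _ _ => by ring
  · rw [Finset.sum_comm]
    exact Finset.sum_congr rfl fun _ _ => Finset.sum_congr rfl fun _ _ => by ring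

lemma actB_r (x : ℂ) (i p q : Fin 8) :
    actB i (fun p q => x * (rZ p q : ℂ)) p q = x * (fZ i p q : ℂ) := by
  have h := congrArg (Int.cast : ℤ → ℂ) (fZ_eq i p q)
  push_cast at h
  have h2 : x * (fZ i p q : ℂ) = x / 2 * (2 * (fZ i p q : ℂ)) := by ring
  rw [h2, ← h]
  simp only [actB, c_eq, zz_eq, Finset.mul_sum, mul_add]
  congr 1 <;> exact Finset.sum_congr rfl fun _ _ => by ring

lemma cocycle_basis (x : ℂ) (i j p q : Fin 8) :
    ∑ k, c i j k * (x * (fZ k p q : ℂ)) =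
      actB i (fun p q => x * (fZ j p q : ℂ)) p q
        - zz i j * actB j (fun p q => x * (fZ i p q : ℂ)) p q := by
  have h := congrArg (fun n : ℤ => x / 2 * (n : ℂ)) (cocycleZ i j p q)
  push_cast at h
  simp only [actB, c_eq, zz_eq]
  simp only [Finset.mul_sum, mul_add, mul_sub] at h ⊢
  convert h using 1
  · exact Finset.sum_congr rfl fun _ _ => by ring
  · congr 1 <;> congr 1 <;> exact Finset.sum_congr rfl fun _ _ => by ring

lemma cocycle_general (x : ℂ) (u v : G) (p q : Fin 8) (s : ℂ)
    (hs : ∀ i j, u i * v j * zz i j = u i * v j * s) :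
    ∑ k, mu u v k * (x * (fZ k p q : ℂ)) =
      (∑ i, u i * actB i (fun p q => ∑ j, v j * (x * (fZ j p q : ℂ))) p q)
      - s * (∑ j, v j * actB j (fun p q => ∑ i, u i * (x * (fZ i p q : ℂ))) p q) := by
  have e1 : ∑ k, mu u v k * (x * (fZ k p q : ℂ)) =
      ∑ i, ∑ j, u i * v j * ∑ k, c i j k * (x * (fZ k p q : ℂ)) := by
    simp only [mu, Finset.sum_mul, Finset.mul_sum]
    rw [Finset.sum_comm]
    refine Finset.sum_congr rfl fun i _ => ?_
    rw [Finset.sum_comm]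
    exact Finset.sum_congr rfl fun _ _ => Finset.sum_congr rfl fun _ _ => by ring
  have e2 : ∀ (i : Fin 8) (w : G),
      actB i (fun p q => ∑ j, w j * (x * (fZ j p q : ℂ))) p q =
        ∑ j, w j * actB i (fun p q => x * (fZ j p q : ℂ)) p q := fun i w =>
    actB_sum i w (fun j p q => x * (fZ j p q : ℂ)) p q
  rw [e1]
  simp only [e2, cocycle_basis, Finset.mul_sum]
  rw [Finset.sum_comm (f := fun j i => s * (v j * (u i * _))), ← Finset.sum_sub_distrib]
  refine Finset.sum_congr rfl fun i _ => ?_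
  rw [← Finset.sum_sub_distrib]
  refine Finset.sum_congr rfl fun j _ => ?_
  have := hs i j
  linear_combination (-actB j (fun p q => x * (fZ i p q : ℂ)) p q) * this

/-- `r = x(X₊∧X₋ + V₊∧W₋ + ½V₋∧V₋ + ½W₊∧W₊)` defines a co-Lie structure
on `osp(2|2)` via `δ_r(z) = z·r`. -/
theorem stmt11 (x : ℂ) :
    IsCoLie (actL (x • (wdg 1 2 + wdg 4 7
      + (1/2 : ℂ) • wdg 5 5 + (1/2 : ℂ) • wdg 6 6))) := by
  rw [r_eq]
  have hd : ∀ u : G, actL (fun p q => x * (rZ p q : ℂ)) u =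
      fun p q => ∑ j, u j * (x * (fZ j p q : ℂ)) := by
    intro u
    funext p q
    simp only [actL_apply, actB_r]
  have he : ∀ i p q, actL (fun p q => x * (rZ p q : ℂ)) (e i) p q = x * (fZ i p q : ℂ) := by
    intro i p q
    rw [hd]
    simp [e, Pi.single_apply]
  refine ⟨⟨?_, ?_⟩, ?_, ?_, ?_, ?_⟩
  · intro u hu p q hpq
    rw [hd]
    refine Finset.sum_eq_zero fun i _ => ?_
    by_cases hi : 4 ≤ i.val
    · simp [hu i hi]
    · have hg : gr i = 0 := by simp [gr]; omega
      rw [parityZ i p q (by omega)]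
      simp
  · intro u hu p q hpq
    rw [hd]
    refine Finset.sum_eq_zero fun i _ => ?_
    by_cases hi : i.val < 4
    · simp [hu i hi]
    · have hg : gr i = 1 := by simp [gr]; omega
      rw [parityZ i p q (by omega)]
      simp
  · intro i j k
    rw [he, he, zz_eq, antisymZ i j k]
    push_cast
    ring
  · intro i k l m
    have h := congrArg (fun n : ℤ => x ^ 2 * (n : ℂ)) (coJacobiZ i k l m)
    push_cast at h
    rw [mul_zero, Finset.mul_sum] at h
    rw [← h]
    refine Finset.sum_congr rfl fun j _ => ?_
    simp only [he, zz_eq]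
    ring
  · intro u v huv
    funext p q
    rw [Pi.sub_apply, Pi.sub_apply, hd, hd, hd, actL_apply, actL_apply]
    have h := cocycle_general x u v p q 1 ?_
    · rw [one_mul] at h
      exact h
    · intro i j
      by_cases hi : i.val < 4
      · simp [zz, gr, hi]
      by_cases hj : j.val < 4
      · simp [zz, gr, hj]
      rcases huv with h | h
      · simp [h i (by omega)]
      · simp [h j (by omega)]
  · intro u v hu hv
    funext p q
    rw [Pi.add_apply, Pi.add_apply, hd, hd, hd, actL_apply, actL_apply]
    have h := cocycle_general x u v p q (-1) ?_
    · rw [neg_one_mul, sub_neg_eq_add] at h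
      exact h
    · intro i j
      by_cases hi : i.val < 4
      · simp [hu i hi]
      by_cases hj : j.val < 4
      · simp [hv j hj]
      simp [zz, gr, hi, hj]

end
end

section
/- For all complex numbers Y, K, L with Y ≠ 0 and K ≠ 0, consider r = Y H∧X₊ − (L(2K+L)/Y) H∧X₋ − (K+L) X₊∧X₋ + K(V₊∧W₋ − V₋∧W₊) in G⊗G for the osp(2|2) Lie superalgebra G. Then there exists an even automorphism A of G such that (A⊗A)(r) = −K(X₊∧X₋ − V₊∧W₋ + V₋∧W₊), where A⊗A acts on G⊗G factorwise. -/
noncomputable section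

open scoped BigOperators

/-- An even automorphism of `osp(2|2)`: a bijective linear map preserving the
grading and the bracket. -/
def IsEvenAut (A : G →ₗ[ℂ] G) : Prop :=
  Function.Bijective A ∧ (∀ v, isEven v → isEven (A v)) ∧
    (∀ v, isOdd v → isOdd (A v)) ∧ ∀ x y, A (mu x y) = mu (A x) (A y)

/-- The factorwise action `A ⊗ A` on `G ⊗ G`. -/
def mapT (A : G →ₗ[ℂ] G) (s : TT) : TT :=
  fun p q => ∑ i, ∑ j, s i j * A (e i) p * A (e j) q

set_option maxHeartbeats 4000000 in
/-- Explicit form of the bracket. -/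
lemma mu_eq (u v : G) : mu u v =
    ![-2 * (u 1 * v 2 - u 2 * v 1) + (u 4 * v 7 + u 7 * v 4) + (u 6 * v 5 + u 5 * v 6),
      (u 0 * v 1 - u 1 * v 0) + (u 4 * v 6 + u 6 * v 4),
      -(u 0 * v 2 - u 2 * v 0) + (u 5 * v 7 + u 7 * v 5),
      -(u 4 * v 7 + u 7 * v 4) + (u 6 * v 5 + u 5 * v 6),
      (u 0 * v 4 - u 4 * v 0) / 2 + (u 3 * v 4 - u 4 * v 3) / 2 - (u 1 * v 5 - u 5 * v 1),
      -(u 0 * v 5 - u 5 * v 0) / 2 + (u 3 * v 5 - u 5 * v 3) / 2 + (u 2 * v 4 - u 4 * v 2),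
      (u 0 * v 6 - u 6 * v 0) / 2 - (u 3 * v 6 - u 6 * v 3) / 2 - (u 1 * v 7 - u 7 * v 1),
      -(u 0 * v 7 - u 7 * v 0) / 2 - (u 3 * v 7 - u 7 * v 3) / 2 + (u 2 * v 6 - u 6 * v 2)] := by
  funext k
  fin_cases k <;> simp [mu, c, cNat, Fin.sum_univ_eight] <;> ring

/-- The action of the matrix `[[a, b], [s, d]]` on `osp(2|2)`. -/
def act (a b s d : ℂ) : G →ₗ[ℂ] G where
  toFun u := ![(a * d + b * s) * u 0 + 2 * a * s * u 1 + 2 * b * d * u 2,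
      a * b * u 0 + a ^ 2 * u 1 + b ^ 2 * u 2,
      s * d * u 0 + s ^ 2 * u 1 + d ^ 2 * u 2,
      u 3,
      a * u 4 + b * u 5, s * u 4 + d * u 5,
      a * u 6 + b * u 7, s * u 6 + d * u 7]
  map_add' u v := by
    funext k
    fin_cases k <;> simp <;> ring
  map_smul' r u := by
    funext k
    fin_cases k <;> simp <;> ring

lemma act_apply (a b s d : ℂ) (u : G) : act a b s d u =
    ![(a * d + b * s) * u 0 + 2 * a * s * u 1 + 2 * b * d * u 2,
      a * b * u 0 + a ^ 2 * u 1 + b ^ 2 * u 2,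
      s * d * u 0 + s ^ 2 * u 1 + d ^ 2 * u 2,
      u 3,
      a * u 4 + b * u 5, s * u 4 + d * u 5,
      a * u 6 + b * u 7, s * u 6 + d * u 7] := rfl

lemma act_inv (a b s d : ℂ) (h : a * d - b * s = 1) (u : G) :
    act d (-b) (-s) a (act a b s d u) = u := by
  have h2 : (a * d - b * s) ^ 2 = 1 := by rw [h]; ring
  funext k
  fin_cases k <;> simp [act_apply]
  · linear_combination u 0 * h2
  · linear_combination u 1 * h2
  · linear_combination u 2 * h2
  · linear_combination u 4 * h
  · linear_combination u 5 * h
  · linear_combination u 6 * h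
  · linear_combination u 7 * h

lemma act_mu (a b s d : ℂ) (h : a * d - b * s = 1) (u v : G) :
    act a b s d (mu u v) = mu (act a b s d u) (act a b s d v) := by
  funext k
  rw [mu_eq, mu_eq]
  fin_cases k <;> simp [act_apply]
  · linear_combination (-((a * d + b * s) * (-2 * (u 1 * v 2 - u 2 * v 1))
      + 2 * a * s * (u 0 * v 1 - u 1 * v 0) - 2 * b * d * (u 0 * v 2 - u 2 * v 0))) * h
  · linear_combination (-(a * b * (-2 * (u 1 * v 2 - u 2 * v 1))
      + a ^ 2 * (u 0 * v 1 - u 1 * v 0) - b ^ 2 * (u 0 * v 2 - u 2 * v 0))) * h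
  · linear_combination (-(s * d * (-2 * (u 1 * v 2 - u 2 * v 1))
      + s ^ 2 * (u 0 * v 1 - u 1 * v 0) - d ^ 2 * (u 0 * v 2 - u 2 * v 0))) * h
  · linear_combination (-(-(u 4 * v 7 + u 7 * v 4) + (u 6 * v 5 + u 5 * v 6))) * h
  · linear_combination (-(a * ((u 0 * v 4 - u 4 * v 0) / 2 - (u 1 * v 5 - u 5 * v 1))
      + b * (-(u 0 * v 5 - u 5 * v 0) / 2 + (u 2 * v 4 - u 4 * v 2)))) * h
  · linear_combination (-(s * ((u 0 * v 4 - u 4 * v 0) / 2 - (u 1 * v 5 - u 5 * v 1))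
      + d * (-(u 0 * v 5 - u 5 * v 0) / 2 + (u 2 * v 4 - u 4 * v 2)))) * h
  · linear_combination (-(a * ((u 0 * v 6 - u 6 * v 0) / 2 - (u 1 * v 7 - u 7 * v 1))
      + b * (-(u 0 * v 7 - u 7 * v 0) / 2 + (u 2 * v 6 - u 6 * v 2)))) * h
  · linear_combination (-(s * ((u 0 * v 6 - u 6 * v 0) / 2 - (u 1 * v 7 - u 7 * v 1))
      + d * (-(u 0 * v 7 - u 7 * v 0) / 2 + (u 2 * v 6 - u 6 * v 2)))) * h

lemma act_aut (a b s d : ℂ) (h : a * d - b * s = 1) : IsEvenAut (act a b s d) := by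
  refine ⟨⟨?_, ?_⟩, ?_, ?_, act_mu a b s d h⟩
  · exact Function.LeftInverse.injective (act_inv a b s d h)
  · intro u
    refine ⟨act d (-b) (-s) a u, ?_⟩
    have := act_inv d (-b) (-s) a (by linear_combination h) u
    simpa using this
  · intro v hv i hi
    have h4 := hv 4 (by decide)
    have h5 := hv 5 (by decide)
    have h6 := hv 6 (by decide)
    have h7 := hv 7 (by decide)
    fin_cases i <;> simp_all [act_apply]
  · intro v hv i hi
    have h0 := hv 0 (by decide)
    have h1 := hv 1 (by decide)
    have h2 := hv 2 (by decide)
    have h3 := hv 3 (by decide)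
    fin_cases i <;> simp_all [act_apply]

/-- Expansion of `A ⊗ A` on a wedge. -/
lemma mapT_wdg (A : G →ₗ[ℂ] G) (i j p q : Fin 8) : mapT A (wdg i j) p q =
    A (e i) p * A (e j) q - zz i j * (A (e j) p * A (e i) q) := by
  have key : ∀ k l : Fin 8, (∑ x, ∑ y, (if x = k ∧ y = l then (1 : ℂ) else 0)
      * A (e x) p * A (e y) q) = A (e k) p * A (e l) q := by
    intro k l
    rw [Finset.sum_eq_single k, Finset.sum_eq_single l]
    · simp
    · intro y _ hy
      simp [hy]
    · simp
    · intro x _ hx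
      simp [hx]
    · simp
  rw [← key i j, ← key j i]
  simp only [mapT, wdg, Finset.mul_sum, ← Finset.sum_sub_distrib]
  refine Finset.sum_congr rfl fun x _ => Finset.sum_congr rfl fun y _ => ?_
  ring

lemma mapT_add (A : G →ₗ[ℂ] G) (s t : TT) : mapT A (s + t) = mapT A s + mapT A t := by
  funext p q
  simp only [mapT, Pi.add_apply, ← Finset.sum_add_distrib]
  refine Finset.sum_congr rfl fun x _ => Finset.sum_congr rfl fun y _ => ?_
  ring

lemma mapT_smul (A : G →ₗ[ℂ] G) (r : ℂ) (t : TT) : mapT A (r • t) = r • mapT A t := by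
  funext p q
  simp only [mapT, Pi.smul_apply, smul_eq_mul, Finset.mul_sum]
  refine Finset.sum_congr rfl fun x _ => Finset.sum_congr rfl fun y _ => ?_
  ring

lemma mapT_sub (A : G →ₗ[ℂ] G) (s t : TT) : mapT A (s - t) = mapT A s - mapT A t := by
  funext p q
  simp only [mapT, Pi.sub_apply, ← Finset.sum_sub_distrib]
  refine Finset.sum_congr rfl fun x _ => Finset.sum_congr rfl fun y _ => ?_
  ring

set_option maxHeartbeats 4000000 in
/-- Case 3, `K ≠ 0`: the generic computer solution is equivalent, by an
even automorphism, to the standard `r`-matrix `−K(X₊∧X₋ − V₊∧W₋ + V₋∧W₊)`. -/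
theorem stmt16 (Y K L : ℂ) (hY : Y ≠ 0) (hK : K ≠ 0) :
    ∃ A : G →ₗ[ℂ] G, IsEvenAut A ∧
      mapT A (Y • wdg 0 1 + (-(L * (2 * K + L) / Y)) • wdg 0 2
          + (-(K + L)) • wdg 1 2 + K • (wdg 4 7 - wdg 5 6))
        = (-K) • (wdg 1 2 - wdg 4 7 + wdg 5 6) := by
  refine ⟨act (-(2 * K + L) / Y) 1 (L / (2 * K)) (-Y / (2 * K)), act_aut _ _ _ _ ?_, ?_⟩
  · field_simp
    ring
  simp only [mapT_add, mapT_smul, mapT_sub]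
  funext p q
  simp only [Pi.add_apply, Pi.smul_apply, Pi.sub_apply, smul_eq_mul, mapT_wdg]
  fin_cases p <;> fin_cases q <;> simp [act_apply, e, wdg, zz, gr] <;>
    field_simp <;> first | ring1 | (ring_nf; simp)

end
end
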